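/- Let (μ_k) be a divergent strictly increasing sequence of positive numbers preserving addition and unit increment, and let f have an asymptotic expansion f(t) ~ Σ_{k=1}^∞ p_k(ln t) t^{-μ_k} with ℝⁿ-valued polynomials p_k. Then any solution y of y' = −Ay + G(y) + f(t) decaying to 0 admits the expansion y(t) ~ Σ_{k=1}^∞ q_k(ln t) t^{-μ_k}, where q_k = A^{-1}( Σ_{m≥2} Σ_{μ_{j_1}+…+μ_{j_m}=μ_k} 𝒢_m(q_{j_1},…,q_{j_m}) + p_k + χ_k ), with χ_k = μ_λ q_λ − q_λ' if there is λ ∈ [1,k−1] with μ_λ + 1 = μ_k, and χ_k = 0 otherwise. -/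

import Mathlib

/-- An `X`-valued polynomial function of one real variable. -/
def IsPolyFun {X : Type*} [AddCommGroup X] [Module ℝ X] (q : ℝ → X) : Prop :=
  ∃ (N : ℕ) (a : ℕ → X), ∀ t : ℝ, q t = ∑ k ∈ Finset.range (N + 1), t ^ k • a k

open Filter Asymptotics Topology

set_option linter.unusedSectionVars false

section PolyFun
variable {X : Type*} [AddCommGroup X] [Module ℝ X]

theorem IsPolyFun.extend {q : ℝ → X} (h : IsPolyFun q) :
    ∃ N : ℕ, ∀ M ≥ N, ∃ a : ℕ → X, ∀ t : ℝ, q t = ∑ k ∈ Finset.range (M + 1), t ^ k • a k := by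
  obtain ⟨N, a, ha⟩ := h
  refine ⟨N, fun M hM => ⟨fun k => if k < N + 1 then a k else 0, fun t => ?_⟩⟩
  rw [ha t]
  have hsub : Finset.range (N + 1) ⊆ Finset.range (M + 1) :=
    Finset.range_subset_range.2 (by omega)
  rw [← Finset.sum_subset hsub]
  · refine Finset.sum_congr rfl fun k hk => ?_
    simp only [if_pos (Finset.mem_range.1 hk)]
  · intro k _ hk
    have hk' : ¬ k < N + 1 := by simpa using hk
    simp only [if_neg hk', smul_zero]

theorem IsPolyFun.monomial (j : ℕ) (a : X) : IsPolyFun (fun t : ℝ => t ^ j • a) := by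
  refine ⟨j, fun k => if k = j then a else 0, fun t => ?_⟩
  simp

theorem IsPolyFun.zero : IsPolyFun (fun _ : ℝ => (0 : X)) :=
  ⟨0, fun _ => 0, fun t => by simp⟩

theorem IsPolyFun.add {q r : ℝ → X} (hq : IsPolyFun q) (hr : IsPolyFun r) :
    IsPolyFun (fun t => q t + r t) := by
  obtain ⟨N, hN⟩ := hq.extend
  obtain ⟨M, hM⟩ := hr.extend
  obtain ⟨a, ha⟩ := hN (max N M) (le_max_left _ _)
  obtain ⟨b, hb⟩ := hM (max N M) (le_max_right _ _)
  refine ⟨max N M, fun k => a k + b k, fun t => ?_⟩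
  simp only [ha, hb, ← Finset.sum_add_distrib, smul_add]

theorem IsPolyFun.sum {ι : Type*} (s : Finset ι) {q : ι → ℝ → X} (h : ∀ i ∈ s, IsPolyFun (q i)) :
    IsPolyFun (fun t => ∑ i ∈ s, q i t) := by
  classical
  induction s using Finset.induction_on with
  | empty => simpa using IsPolyFun.zero
  | insert i s hi ih =>
    simp only [Finset.sum_insert hi]
    exact (h i (by simp)).add (ih fun j hj => h j (by simp [hj]))

theorem IsPolyFun.linear {Y : Type*} [AddCommGroup Y] [Module ℝ Y] {q : ℝ → X}
    (h : IsPolyFun q) (L : X →ₗ[ℝ] Y) : IsPolyFun (fun t => L (q t)) := by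
  obtain ⟨N, a, ha⟩ := h
  refine ⟨N, fun k => L (a k), fun t => ?_⟩
  simp [ha t, map_sum]

theorem IsPolyFun.smul {q : ℝ → X} (h : IsPolyFun q) (c : ℝ) : IsPolyFun (fun t => c • q t) :=
  h.linear (c • LinearMap.id)

theorem IsPolyFun.sub {q r : ℝ → X} (hq : IsPolyFun q) (hr : IsPolyFun r) :
    IsPolyFun (fun t => q t - r t) := by
  simpa [sub_eq_add_neg] using hq.add (hr.smul (-1))

theorem IsPolyFun.multilinear {Y : Type*} [AddCommGroup Y] [Module ℝ Y] {m : ℕ}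
    (F : MultilinearMap ℝ (fun _ : Fin m => X) Y) {q : Fin m → ℝ → X}
    (h : ∀ i, IsPolyFun (q i)) : IsPolyFun (fun t => F (fun i => q i t)) := by
  choose N a ha using h
  have : (fun t => F (fun i => q i t)) = fun t =>
      ∑ r ∈ Fintype.piFinset (fun i => Finset.range (N i + 1)),
        t ^ (∑ i, r i) • F (fun i => a i (r i)) := by
    funext t
    simp only [ha]
    rw [MultilinearMap.map_sum_finset]
    refine Finset.sum_congr rfl fun r _ => ?_
    rw [MultilinearMap.map_smul_univ, Finset.prod_pow_eq_pow_sum]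
  rw [this]
  exact IsPolyFun.sum _ fun r _ => IsPolyFun.monomial _ _

end PolyFun

section Normed
variable {X : Type*} [NormedAddCommGroup X] [NormedSpace ℝ X]

theorem IsPolyFun.exists_deriv {q : ℝ → X} (h : IsPolyFun q) :
    (∀ t, HasDerivAt q (deriv q t) t) ∧ IsPolyFun (deriv q) := by
  obtain ⟨N, a, ha⟩ := h
  have hq : q = fun t => ∑ k ∈ Finset.range (N + 1), t ^ k • a k := funext ha
  have hd : ∀ t, HasDerivAt q (∑ k ∈ Finset.range (N + 1), ((k : ℝ) * t ^ (k - 1)) • a k) t := by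
    intro t
    rw [hq]
    refine HasDerivAt.fun_sum fun k _ => ?_
    exact (hasDerivAt_pow k t).smul_const (a k)
  refine ⟨fun t => (hd t).differentiableAt.hasDerivAt, ?_⟩
  have : deriv q = fun t => ∑ k ∈ Finset.range (N + 1), t ^ (k - 1) • ((k : ℝ) • a k) := by
    funext t
    rw [(hd t).deriv]
    refine Finset.sum_congr rfl fun k _ => ?_
    rw [smul_smul, mul_comm]
  rw [this]
  exact IsPolyFun.sum _ fun k _ => IsPolyFun.monomial _ _

/-- `h` decays faster than `t ^ (-c)` by a power. -/
def Sm (c : ℝ) (h : ℝ → X) : Prop := ∃ β > c, h =O[atTop] fun t : ℝ => t ^ (-β)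

theorem rpow_neg_isBigO {a b : ℝ} (h : a ≤ b) :
    (fun t : ℝ => t ^ (-b)) =O[atTop] fun t : ℝ => t ^ (-a) := by
  refine IsBigO.of_bound 1 ?_
  filter_upwards [eventually_ge_atTop (1 : ℝ)] with t ht
  have h0 : 0 < t := by linarith
  rw [Real.norm_of_nonneg (Real.rpow_nonneg h0.le _), Real.norm_of_nonneg (Real.rpow_nonneg h0.le _),
    one_mul]
  exact Real.rpow_le_rpow_of_exponent_le ht (by linarith)

theorem Sm.zero (c : ℝ) : Sm c (fun _ => (0 : X)) := ⟨c + 1, by linarith, isBigO_zero _ _⟩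

theorem Sm.add {c : ℝ} {g h : ℝ → X} (hg : Sm c g) (hh : Sm c h) : Sm c (fun t => g t + h t) := by
  obtain ⟨β, hβ, h1⟩ := hg
  obtain ⟨γ, hγ, h2⟩ := hh
  exact ⟨min β γ, lt_min hβ hγ, (h1.trans (rpow_neg_isBigO (min_le_left _ _))).add
    (h2.trans (rpow_neg_isBigO (min_le_right _ _)))⟩

theorem Sm.neg {c : ℝ} {g : ℝ → X} (hg : Sm c g) : Sm c (fun t => - g t) := by
  obtain ⟨β, hβ, h1⟩ := hg
  exact ⟨β, hβ, h1.neg_left⟩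

theorem Sm.sum {ι : Type*} {c : ℝ} (s : Finset ι) {g : ι → ℝ → X} (h : ∀ i ∈ s, Sm c (g i)) :
    Sm c (fun t => ∑ i ∈ s, g i t) := by
  classical
  induction s using Finset.induction_on with
  | empty => simpa using Sm.zero c
  | insert i s hi ih =>
    simp only [Finset.sum_insert hi]
    exact (h i (by simp)).add (ih fun j hj => h j (by simp [hj]))

theorem Sm.mono {c d : ℝ} {g : ℝ → X} (hg : Sm c g) (h : d ≤ c) : Sm d g := by
  obtain ⟨β, hβ, h1⟩ := hg
  exact ⟨β, by linarith, h1⟩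

theorem Sm.tendsto {g : ℝ → X} (hg : Sm 0 g) : Tendsto g atTop (𝓝 0) := by
  obtain ⟨β, hβ, h1⟩ := hg
  exact h1.trans_tendsto (tendsto_rpow_neg_atTop hβ)

theorem Sm.poly {c γ : ℝ} (h : c < γ) {q : ℝ → X} (hq : IsPolyFun q) :
    Sm c (fun t : ℝ => t ^ (-γ) • q (Real.log t)) := by
  obtain ⟨N, a, ha⟩ := hq
  have : (fun t : ℝ => t ^ (-γ) • q (Real.log t)) =
      fun t : ℝ => ∑ k ∈ Finset.range (N + 1), (t ^ (-γ) * Real.log t ^ k) • a k := by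
    funext t
    simp [ha, Finset.smul_sum, smul_smul]
  rw [this]
  refine Sm.sum _ fun k _ => ⟨(c + γ) / 2, by linarith, ?_⟩
  have h1 : (fun t : ℝ => Real.log t ^ k) =O[atTop] fun t : ℝ => t ^ ((γ - c) / 2) := by
    have := (isLittleO_log_rpow_rpow_atTop (s := (γ - c) / 2) (k : ℝ) (by linarith)).isBigO
    simpa using this
  have h2 : (fun t : ℝ => t ^ (-γ) * Real.log t ^ k) =O[atTop]
      fun t : ℝ => t ^ (-γ) * t ^ ((γ - c) / 2) := (isBigO_refl _ _).mul h1
  have h3 : (fun t : ℝ => t ^ (-γ) * t ^ ((γ - c) / 2)) =ᶠ[atTop]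
      fun t : ℝ => t ^ (-((c + γ) / 2)) := by
    filter_upwards [eventually_gt_atTop (0 : ℝ)] with t ht
    rw [← Real.rpow_add ht]
    congr 1
    ring
  have h4 := (h2.trans_eventuallyEq h3).smul (isBigO_refl (fun _ : ℝ => a k) atTop)
  refine h4.trans ?_
  have h5 : (fun t : ℝ => t ^ (-((c + γ) / 2)) • a k) =O[atTop]
      fun t : ℝ => t ^ (-((c + γ) / 2)) := by
    refine IsBigO.of_bound ‖a k‖ (Eventually.of_forall fun t => ?_)
    rw [norm_smul, mul_comm]
  exact h5

theorem Sm.regroup {ι : Type*} [DecidableEq ι] {μ : ℕ → ℝ} (hμ : StrictMono μ) (N : ℕ)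
    (J : Finset ι) (σ : ι → ℝ) (hσ : ∀ x ∈ J, ∃ c, μ c = σ x) (Z : ι → ℝ → X)
    (hZ : ∀ x ∈ J, IsPolyFun (Z x)) :
    Sm (μ N) (fun t : ℝ => ∑ x ∈ J, t ^ (-σ x) • Z x (Real.log t) -
      ∑ k ∈ Finset.range (N + 1), t ^ (-μ k) • ∑ x ∈ J with σ x = μ k, Z x (Real.log t)) := by
  have : (fun t : ℝ => ∑ x ∈ J, t ^ (-σ x) • Z x (Real.log t) -
      ∑ k ∈ Finset.range (N + 1), t ^ (-μ k) • ∑ x ∈ J with σ x = μ k, Z x (Real.log t)) =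
      fun t : ℝ => ∑ x ∈ J, (t ^ (-σ x) • Z x (Real.log t) -
        ∑ k ∈ Finset.range (N + 1), if σ x = μ k then t ^ (-μ k) • Z x (Real.log t) else 0) := by
    funext t
    rw [Finset.sum_sub_distrib, Finset.sum_comm (s := J)]
    congr 1
    refine Finset.sum_congr rfl fun k _ => ?_
    rw [Finset.sum_filter, Finset.smul_sum]
    refine Finset.sum_congr rfl fun x _ => ?_
    split_ifs <;> simp
  rw [this]
  refine Sm.sum _ fun x hx => ?_
  obtain ⟨c, hc⟩ := hσ x hx
  simp only [← hc, hμ.injective.eq_iff]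
  by_cases hcN : c < N + 1
  · have : (fun t : ℝ => t ^ (-μ c) • Z x (Real.log t) -
        ∑ k ∈ Finset.range (N + 1), if c = k then t ^ (-μ k) • Z x (Real.log t) else 0) =
        fun _ => 0 := by
      funext t
      rw [Finset.sum_ite_eq, if_pos (Finset.mem_range.2 hcN), sub_self]
    rw [this]
    exact Sm.zero _
  · have : (fun t : ℝ => t ^ (-μ c) • Z x (Real.log t) -
        ∑ k ∈ Finset.range (N + 1), if c = k then t ^ (-μ k) • Z x (Real.log t) else 0) =
        fun t : ℝ => t ^ (-μ c) • Z x (Real.log t) := by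
      funext t
      rw [Finset.sum_ite_eq, if_neg (by simpa using hcN), sub_zero]
    rw [this]
    exact Sm.poly (hμ (by omega)) (hZ x hx)

end Normed

theorem multilinear_bound {n m : ℕ}
    (F : MultilinearMap ℝ (fun _ : Fin m => (Fin n → ℝ)) (Fin n → ℝ)) :
    ∃ C : ℝ, 0 ≤ C ∧ ∀ v : Fin m → Fin n → ℝ, ‖F v‖ ≤ C * ∏ i, ‖v i‖ := by
  classical
  refine ⟨∑ r : Fin m → Fin n, ‖F fun i => Pi.single (r i) (1 : ℝ)‖, by positivity, fun v => ?_⟩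
  have hv : v = fun i => ∑ j, v i j • (Pi.single j (1 : ℝ) : Fin n → ℝ) := by
    funext i
    exact pi_eq_sum_univ' (v i)
  have h1 : F v = ∑ r : Fin m → Fin n,
      (∏ i, v i (r i)) • F fun i => Pi.single (r i) (1 : ℝ) := by
    conv_lhs => rw [hv]
    rw [MultilinearMap.map_sum]
    refine Finset.sum_congr rfl fun r _ => ?_
    rw [MultilinearMap.map_smul_univ]
  rw [h1, Finset.sum_mul]
  refine (norm_sum_le _ _).trans (Finset.sum_le_sum fun r _ => ?_)
  rw [norm_smul, mul_comm, norm_prod]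
  gcongr with i _
  exact norm_le_pi_norm (v i) (r i)

theorem multilinear_isLittleO {n m : ℕ} (hm : 2 ≤ m)
    (F : MultilinearMap ℝ (fun _ : Fin m => (Fin n → ℝ)) (Fin n → ℝ))
    {v w : ℝ → Fin n → ℝ} (hv : Tendsto v atTop (𝓝 0)) (hw : Tendsto w atTop (𝓝 0)) :
    (fun t => F (fun _ => v t) - F (fun _ => w t)) =o[atTop] fun t => v t - w t := by
  obtain ⟨C, hC, hb⟩ := multilinear_bound F
  have : Nonempty (Fin m) := ⟨⟨0, by omega⟩⟩
  have key : ∀ t, ‖F (fun _ => v t) - F (fun _ => w t)‖ ≤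
      (C * m * max ‖v t‖ ‖w t‖ ^ (m - 1)) * ‖v t - w t‖ := by
    intro t
    have := F.norm_image_sub_le_of_bound hC hb (fun _ => v t) (fun _ => w t)
    have e : (fun _ : Fin m => v t) - (fun _ : Fin m => w t) = fun _ => v t - w t := rfl
    rw [e] at this
    simpa [pi_norm_const] using this
  have hlim : Tendsto (fun t => C * m * max ‖v t‖ ‖w t‖ ^ (m - 1)) atTop (𝓝 0) := by
    have h1 : Tendsto (fun t => max ‖v t‖ ‖w t‖) atTop (𝓝 0) := by
      simpa using (hv.norm).max (hw.norm)
    have h2 := (h1.pow (m - 1)).const_mul (C * m)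
    rwa [zero_pow (by omega), mul_zero] at h2
  refine IsLittleO.of_bound fun ε hε => ?_
  filter_upwards [hlim.eventually (gt_mem_nhds hε)] with t ht
  exact (key t).trans (by gcongr)

/-- Scalar comparison. -/
theorem scalar_comparison {u u' : ℝ → ℝ} {lam D γ T : ℝ} (hlam : 0 < lam) (hγ : 0 < γ)
    (hu : ∀ t ≥ T, HasDerivAt u (u' t) t)
    (hle : ∀ t ≥ T, u' t ≤ -lam * u t + D * t ^ (-γ)) :
    ∃ B T', ∀ t ≥ T', u t ≤ B * t ^ (-γ) := by
  set T1 := max (max T 1) (2 * γ / lam) with hT1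
  have hT1T : T ≤ T1 := (le_max_left _ _).trans (le_max_left _ _)
  have hT11 : 1 ≤ T1 := (le_max_right _ _).trans (le_max_left _ _)
  have hT1g : 2 * γ / lam ≤ T1 := le_max_right _ _
  have hp : ∀ t ≥ T1, 0 < t := fun t ht => by linarith
  set B := max (2 * |D| / lam) (|u T1| / T1 ^ (-γ)) with hB
  have hBD : 2 * |D| / lam ≤ B := le_max_left _ _
  have hB0 : 0 ≤ B := le_trans (by positivity) hBD
  have hBu : u T1 ≤ B * T1 ^ (-γ) := by
    have h1 : |u T1| / T1 ^ (-γ) ≤ B := le_max_right _ _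
    rw [div_le_iff₀ (Real.rpow_pos_of_pos (hp _ le_rfl) _)] at h1
    exact (le_abs_self _).trans h1
  let F : ℝ → ℝ := fun t => Real.exp (lam * t) * (u t - B * t ^ (-γ))
  have hF : ∀ t ≥ T1, HasDerivAt F (Real.exp (lam * t) * lam * (u t - B * t ^ (-γ)) +
      Real.exp (lam * t) * (u' t - B * ((-γ) * t ^ (-γ - 1)))) t := by
    intro t ht
    have h1 : HasDerivAt (fun t => Real.exp (lam * t)) (Real.exp (lam * t) * lam) t := by
      simpa using ((hasDerivAt_id t).const_mul lam).exp
    have h2 : HasDerivAt (fun t : ℝ => t ^ (-γ)) ((-γ) * t ^ (-γ - 1)) t :=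
      Real.hasDerivAt_rpow_const (Or.inl (hp t ht).ne')
    exact h1.mul ((hu t (hT1T.trans ht)).sub (h2.const_mul B))
  have hanti : AntitoneOn F (Set.Ici T1) := by
    refine antitoneOn_of_deriv_nonpos (convex_Ici _)
      (fun t ht => (hF t ht).continuousAt.continuousWithinAt)
      (fun t ht => ?_) (fun t ht => ?_)
    · rw [interior_Ici] at ht
      exact (hF t (le_of_lt ht)).differentiableAt.differentiableWithinAt
    · rw [interior_Ici] at ht
      have ht' : t ≥ T1 := le_of_lt ht
      have ht0 := hp t ht'
      rw [(hF t ht').deriv]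
      have hr := Real.rpow_pos_of_pos ht0 (-γ)
      have e1 : t ^ (-γ - 1) = t ^ (-γ) / t := by
        rw [Real.rpow_sub ht0, Real.rpow_one]
      have h3 := hle t (hT1T.trans ht')
      have h4 : γ / t ≤ lam / 2 := by
        rw [div_le_iff₀ ht0]
        rw [div_le_iff₀ hlam] at hT1g
        nlinarith
      have h5 : D ≤ B * (lam / 2) := by
        rw [div_le_iff₀ hlam] at hBD
        have := le_abs_self D
        linarith
      have h6 : lam * (u t - B * t ^ (-γ)) + (u' t - B * ((-γ) * t ^ (-γ - 1))) ≤ 0 := by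
        rw [e1]
        have h7 : B * ((-γ) * (t ^ (-γ) / t)) = - (B * (γ / t)) * t ^ (-γ) := by ring
        rw [h7]
        have h8 : B * (γ / t) ≤ B * (lam / 2) := by gcongr
        have h9 : (D + B * (γ / t) - B * lam) * t ^ (-γ) ≤ 0 :=
          mul_nonpos_of_nonpos_of_nonneg (by linarith) hr.le
        nlinarith
      have := mul_nonpos_of_nonneg_of_nonpos (Real.exp_pos (lam * t)).le h6
      linarith
  refine ⟨B, T1, fun t ht => ?_⟩
  have h1 : F t ≤ F T1 := hanti (Set.self_mem_Ici) ht ht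
  have h2 : F T1 ≤ 0 :=
    mul_nonpos_of_nonneg_of_nonpos (Real.exp_pos _).le (by linarith)
  have h3 : u t - B * t ^ (-γ) ≤ 0 := by
    by_contra hcon
    push Not at hcon
    have := mul_pos (Real.exp_pos (lam * t)) hcon
    have h4 : F t ≤ 0 := h1.trans h2
    exact absurd h4 (not_le.2 this)
  linarith

theorem mulVec_bound {n : ℕ} (M : Matrix (Fin n) (Fin n) ℝ) :
    ∃ K : ℝ, 0 < K ∧ ∀ v : Fin n → ℝ, ‖M.mulVec v‖ ≤ K * ‖v‖ := by
  obtain ⟨K, hK, h⟩ := (LinearMap.toContinuousLinearMap (Matrix.toLin' M)).bound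
  exact ⟨K, hK, fun v => by simpa using h v⟩

theorem linear_decay {n : ℕ} (hn : 0 < n)
    {S : Matrix (Fin n) (Fin n) ℝ} (hS : IsUnit S)
    {Λ : Fin n → ℝ} (hΛ : ∀ i, 0 < Λ i)
    {A : Matrix (Fin n) (Fin n) ℝ} (hA : A = S⁻¹ * Matrix.diagonal Λ * S)
    {w h₁ h₂ : ℝ → Fin n → ℝ} {β : ℝ} (hβ : 0 < β)
    (hw : ∀ᶠ t in atTop, HasDerivAt w (-(A.mulVec (w t)) + (h₁ t + h₂ t)) t)
    (h1 : h₁ =o[atTop] w) (h2 : h₂ =O[atTop] fun t : ℝ => t ^ (-β)) :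
    w =O[atTop] fun t : ℝ => t ^ (-β) := by
  have : Nonempty (Fin n) := ⟨⟨0, hn⟩⟩
  have hdet : IsUnit S.det := (Matrix.isUnit_iff_isUnit_det S).1 hS
  obtain ⟨K, hK, hKb⟩ := mulVec_bound S
  obtain ⟨K', hK', hKb'⟩ := mulVec_bound S⁻¹
  obtain ⟨i0, hi0⟩ := Finite.exists_min Λ
  set lam := Λ i0 with hlamdef
  have hlam : 0 < lam := hΛ i0
  have hn' : (0 : ℝ) < n := by exact_mod_cast hn
  set ε := lam / (4 * n * K * K') with hε
  have hεpos : 0 < ε := by positivity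
  obtain ⟨C, hC, hCb⟩ := h2.exists_pos
  have ev : ∀ᶠ t in atTop, HasDerivAt w (-(A.mulVec (w t)) + (h₁ t + h₂ t)) t ∧
      ‖h₁ t‖ ≤ ε * ‖w t‖ ∧ ‖h₂ t‖ ≤ C * t ^ (-β) ∧ 0 < t := by
    filter_upwards [hw, h1.bound hεpos, hCb.bound, eventually_gt_atTop 0] with t a b c d
    rw [Real.norm_of_nonneg (Real.rpow_nonneg d.le _)] at c
    exact ⟨a, b, c, d⟩
  obtain ⟨T, hT⟩ := eventually_atTop.1 ev
  set z : ℝ → Fin n → ℝ := fun t => S.mulVec (w t) with hz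
  set g : ℝ → Fin n → ℝ := fun t => S.mulVec (h₁ t + h₂ t) with hg
  have hwz : ∀ t, w t = S⁻¹.mulVec (z t) := fun t => by
    simp [hz, Matrix.mulVec_mulVec, Matrix.nonsing_inv_mul S hdet]
  have hSA : S * A = Matrix.diagonal Λ * S := by
    rw [hA, ← mul_assoc, ← mul_assoc, Matrix.mul_nonsing_inv S hdet, one_mul]
  have hzd : ∀ t ≥ T, ∀ i, HasDerivAt (fun t => z t i) (-(Λ i * z t i) + g t i) t := by
    intro t ht i
    have hd : HasDerivAt z (S.mulVec (-(A.mulVec (w t)) + (h₁ t + h₂ t))) t :=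
      ((LinearMap.toContinuousLinearMap (Matrix.toLin' S)).hasFDerivAt.comp_hasDerivAt t
        (hT t ht).1)
    have hd' := (hasDerivAt_pi.1 hd) i
    have e : S.mulVec (-(A.mulVec (w t)) + (h₁ t + h₂ t)) i = -(Λ i * z t i) + g t i := by
      rw [Matrix.mulVec_add, Matrix.mulVec_neg, Matrix.mulVec_mulVec, hSA, ← Matrix.mulVec_mulVec]
      simp only [Pi.add_apply, Pi.neg_apply, Matrix.mulVec_diagonal, hz, hg]
    rw [e] at hd'
    exact hd'
  set u : ℝ → ℝ := fun t => ∑ i, z t i ^ 2 with hu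
  have hzu : ∀ t, ‖z t‖ ^ 2 ≤ u t := by
    intro t
    obtain ⟨i, hi⟩ := Finite.exists_max (fun i => ‖z t i‖)
    have h3 : ‖z t‖ ≤ ‖z t i‖ := (pi_norm_le_iff_of_nonneg (norm_nonneg _)).2 hi
    calc ‖z t‖ ^ 2 ≤ ‖z t i‖ ^ 2 := by gcongr
      _ = z t i ^ 2 := by rw [Real.norm_eq_abs, sq_abs]
      _ ≤ u t := Finset.single_le_sum (f := fun i => z t i ^ 2) (fun _ _ => sq_nonneg _)
          (Finset.mem_univ i)
  have hud : ∀ t ≥ T, HasDerivAt u (∑ i, 2 * z t i * (-(Λ i * z t i) + g t i)) t := by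
    intro t ht
    refine HasDerivAt.fun_sum fun i _ => ?_
    have h3 := (hzd t ht i).fun_pow 2
    simp only [Nat.cast_ofNat, Nat.add_one_sub_one, pow_one] at h3
    exact h3
  have hle : ∀ t ≥ T, (∑ i, 2 * z t i * (-(Λ i * z t i) + g t i)) ≤
      -lam * u t + (2 * (n * K * C) ^ 2 / lam) * t ^ (-(2 * β)) := by
    intro t ht
    obtain ⟨-, hb1, hb2, ht0⟩ := hT t ht
    set P := t ^ (-β) with hP
    have hPP : t ^ (-(2 * β)) = P ^ 2 := by
      rw [hP, ← Real.rpow_natCast, ← Real.rpow_mul ht0.le]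
      congr 1
      push_cast
      ring
    have hP0 : 0 ≤ P := Real.rpow_nonneg ht0.le _
    set Z := ‖z t‖ with hZ
    have hZ0 : 0 ≤ Z := norm_nonneg _
    have hwb : ‖w t‖ ≤ K' * Z := by
      rw [hwz t]
      exact hKb' _
    have hgb : ‖g t‖ ≤ K * (ε * (K' * Z) + C * P) := by
      refine (hKb _).trans ?_
      gcongr
      refine (norm_add_le _ _).trans ?_
      gcongr
      exact hb1.trans (by gcongr)
    have hterm : ∀ i, 2 * z t i * (-(Λ i * z t i) + g t i) ≤
        -(2 * lam) * z t i ^ 2 + 2 * (Z * ‖g t‖) := by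
      intro i
      have h3 : z t i * g t i ≤ Z * ‖g t‖ := by
        refine (le_abs_self _).trans ?_
        rw [abs_mul]
        exact mul_le_mul (norm_le_pi_norm (z t) i) (norm_le_pi_norm (g t) i) (abs_nonneg _) hZ0
      have h4 : lam * z t i ^ 2 ≤ Λ i * z t i ^ 2 :=
        mul_le_mul_of_nonneg_right (hi0 i) (sq_nonneg _)
      nlinarith
    have hs : (∑ i, 2 * z t i * (-(Λ i * z t i) + g t i)) ≤
        -(2 * lam) * u t + n * (2 * (Z * ‖g t‖)) := by
      refine (Finset.sum_le_sum fun i _ => hterm i).trans ?_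
      rw [Finset.sum_add_distrib, ← Finset.mul_sum]
      simp [hu]
    have h5 : n * (2 * (Z * ‖g t‖)) ≤ n * (2 * (Z * (K * (ε * (K' * Z) + C * P)))) := by
      gcongr
    have h6 : n * (2 * (Z * (K * (ε * (K' * Z) + C * P)))) =
        (lam / 2) * Z ^ 2 + 2 * Z * ((n * K * C) * P) := by
      have : n * K * K' * ε = lam / 4 := by
        rw [hε]
        field_simp
      linear_combination (2 * Z ^ 2) * this
    have h7 : 2 * Z * ((n * K * C) * P) ≤ (lam / 2) * Z ^ 2 + (2 * (n * K * C) ^ 2 / lam) * P ^ 2 := by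
      have h8 : (2 * (n * K * C) ^ 2 / lam) * P ^ 2 + (lam / 2) * Z ^ 2 - 2 * Z * ((n * K * C) * P)
          = (lam * Z - 2 * ((n * K * C) * P)) ^ 2 / (2 * lam) := by
        field_simp
        ring
      have h9 : 0 ≤ (lam * Z - 2 * ((n * K * C) * P)) ^ 2 / (2 * lam) := by positivity
      linarith
    have h10 := mul_le_mul_of_nonneg_left (hzu t) hlam.le
    rw [hPP]
    linarith
  obtain ⟨B, T', hB⟩ := scalar_comparison hlam (by linarith : 0 < 2 * β) hud hle
  refine IsBigO.of_bound (K' * Real.sqrt |B|) ?_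
  filter_upwards [eventually_ge_atTop T', eventually_gt_atTop 0] with t ht ht0
  have hP0 : 0 ≤ t ^ (-β) := Real.rpow_nonneg ht0.le _
  have hPP : t ^ (-(2 * β)) = (t ^ (-β)) ^ 2 := by
    rw [← Real.rpow_natCast, ← Real.rpow_mul ht0.le]
    congr 1
    push_cast
    ring
  have h3 : ‖z t‖ ≤ Real.sqrt |B| * t ^ (-β) := by
    refine abs_le_of_sq_le_sq' ?_ (by positivity) |>.2
    rw [mul_pow, Real.sq_sqrt (abs_nonneg B), ← hPP]
    refine (hzu t).trans ((hB t ht).trans ?_)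
    have : 0 ≤ t ^ (-(2 * β)) := Real.rpow_nonneg ht0.le _
    gcongr
    exact le_abs_self B
  rw [Real.norm_of_nonneg hP0, mul_assoc, hwz t]
  refine (hKb' _).trans ?_
  gcongr

section Index
variable {μ : ℕ → ℝ}

theorem index_lt (hμpos : ∀ k, 0 < μ k) (hμmono : StrictMono μ) {m k : ℕ} (hm : 2 ≤ m)
    {j : Fin m → ℕ} (hj : ∑ i, μ (j i) = μ k) (i : Fin m) : j i < k := by
  have : Nontrivial (Fin m) := Fin.nontrivial_iff_two_le.2 hm
  obtain ⟨i', hi'⟩ := exists_ne i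
  have h1 : μ (j i) < ∑ i, μ (j i) :=
    Finset.single_lt_sum (f := fun i => μ (j i)) hi' (Finset.mem_univ _) (Finset.mem_univ _)
      (hμpos _) (fun _ _ _ => (hμpos _).le)
  rw [hj] at h1
  exact hμmono.lt_iff_lt.1 h1

theorem index_card (hμmono : StrictMono μ) {m k : ℕ}
    {j : Fin m → ℕ} (hj : ∑ i, μ (j i) = μ k) : m * μ 0 ≤ μ k := by
  rw [← hj]
  have := Finset.card_nsmul_le_sum Finset.univ (fun i : Fin m => μ (j i)) (μ 0)
    (fun i _ => hμmono.monotone (Nat.zero_le _))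
  simpa using this

theorem index_mem (hμadd : ∀ a b : ℕ, ∃ c : ℕ, μ c = μ a + μ b) :
    ∀ {m : ℕ} (_ : 1 ≤ m) (j : Fin m → ℕ), ∃ c, μ c = ∑ i, μ (j i) := by
  intro m hm
  induction m, hm using Nat.le_induction with
  | base => exact fun j => ⟨j 0, by simp⟩
  | succ m hm ih =>
    intro j
    obtain ⟨c, hc⟩ := ih (fun i => j i.castSucc)
    obtain ⟨d, hd⟩ := hμadd c (j (Fin.last m))
    exact ⟨d, by rw [hd, hc, Fin.sum_univ_castSucc]⟩

/-- The finite set of multi-indices with at most `M` entries, all entries at most `N`. -/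
def idx (M N : ℕ) : Finset (Σ m : ℕ, Fin m → ℕ) :=
  (Finset.Icc 2 M).sigma fun _ => Fintype.piFinset fun _ => Finset.range (N + 1)

theorem finsum_index (hμpos : ∀ k, 0 < μ k) (hμmono : StrictMono μ) {Y : Type*} [AddCommGroup Y]
    {M N k : ℕ} (hkN : k ≤ N) (hM : μ N ≤ M * μ 0) (g : (Σ m : ℕ, Fin m → ℕ) → Y) :
    (∑ᶠ x : {x : Σ m : ℕ, Fin m → ℕ // 2 ≤ x.1 ∧ (∑ i, μ (x.2 i)) = μ k}, g x.1) =
      ∑ x ∈ idx M N with (∑ i, μ (x.2 i)) = μ k, g x := by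
  rw [finsum_subtype_eq_finsum_cond (f := g)
    (fun x : (Σ m : ℕ, Fin m → ℕ) => 2 ≤ x.1 ∧ (∑ i, μ (x.2 i)) = μ k)]
  rw [← finsum_mem_coe_finset]
  refine finsum_congr fun x => ?_
  refine finsum_congr_Prop ?_ (fun _ => rfl)
  simp only [idx, Finset.coe_filter, Finset.mem_sigma, Finset.mem_Icc, Fintype.mem_piFinset,
    Finset.mem_range, Set.mem_ofPred_eq, eq_iff_iff]
  constructor
  · rintro ⟨h1, h2⟩
    refine ⟨⟨⟨h1, ?_⟩, fun i => ?_⟩, h2⟩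
    · have h3 := index_card hμmono h2
      have h4 : μ k ≤ μ N := hμmono.monotone hkN
      have h5 : (x.1 : ℝ) * μ 0 ≤ M * μ 0 := by linarith
      exact_mod_cast le_of_mul_le_mul_right h5 (hμpos 0)
    · have := index_lt hμpos hμmono h1 h2 i
      omega
  · rintro ⟨⟨⟨h1, _⟩, _⟩, h2⟩
    exact ⟨h1, h2⟩

end Index

theorem exists_fix {α : Type*} [Inhabited α] (F : ℕ → (ℕ → α) → α)
    (hF : ∀ k Q Q', (∀ j < k, Q j = Q' j) → F k Q = F k Q') : ∃ q : ℕ → α, ∀ k, q k = F k q := by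
  classical
  let step : ∀ k : ℕ, (∀ j, j < k → α) → α :=
    fun k r => F k (fun j => if h : j < k then r j h else default)
  let q : ℕ → α := WellFounded.fix Nat.lt_wfRel.wf step
  refine ⟨q, fun k => ?_⟩
  have h1 : q k = step k (fun j _ => q j) := WellFounded.fix_eq _ _ _
  rw [h1]
  refine hF _ _ _ fun j hj => ?_
  simp [hj]

theorem exists_coeffs {n : ℕ} (B : Matrix (Fin n) (Fin n) ℝ)
    (𝒢 : ∀ m : ℕ, MultilinearMap ℝ (fun _ : Fin m => (Fin n → ℝ)) (Fin n → ℝ))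
    {μ : ℕ → ℝ} (hμpos : ∀ k, 0 < μ k) (hμmono : StrictMono μ)
    {p : ℕ → ℝ → Fin n → ℝ} (hp : ∀ k, IsPolyFun (p k)) :
    ∃ q χ : ℕ → ℝ → Fin n → ℝ,
      (∀ k, IsPolyFun (q k)) ∧
      (∀ k l : ℕ, μ l + 1 = μ k → χ k = fun s => μ l • q l s - deriv (q l) s) ∧
      (∀ k : ℕ, (¬∃ l, μ l + 1 = μ k) → χ k = 0) ∧
      (∀ (k : ℕ) (s : ℝ),
        q k s = B.mulVec
          ((∑ᶠ x : {x : Σ m : ℕ, Fin m → ℕ // 2 ≤ x.1 ∧ (∑ i, μ (x.2 i)) = μ k},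
              𝒢 x.1.1 (fun i => q (x.1.2 i) s)) + p k s + χ k s)) := by
  classical
  let Xi : ℕ → (ℕ → ℝ → Fin n → ℝ) → ℝ → Fin n → ℝ := fun k Q =>
    if h : ∃ l, μ l + 1 = μ k then fun s => μ h.choose • Q h.choose s - deriv (Q h.choose) s else 0
  let F : ℕ → (ℕ → ℝ → Fin n → ℝ) → ℝ → Fin n → ℝ := fun k Q s => B.mulVec
          ((∑ᶠ x : {x : Σ m : ℕ, Fin m → ℕ // 2 ≤ x.1 ∧ (∑ i, μ (x.2 i)) = μ k},
              𝒢 x.1.1 (fun i => Q (x.1.2 i) s)) + p k s + Xi k Q s)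
  have hlt : ∀ {k l : ℕ}, μ l + 1 = μ k → l < k := fun {k l} h =>
    hμmono.lt_iff_lt.1 (by linarith)
  obtain ⟨q, hq⟩ := exists_fix F (by
    intro k Q Q' hQ
    have h1 : Xi k Q = Xi k Q' := by
      simp only [Xi]
      split_ifs with h
      · rw [hQ _ (hlt h.choose_spec)]
      · rfl
    funext s
    simp only [F]
    rw [h1]
    congr 3
    refine finsum_congr fun x => ?_
    congr 1
    funext i
    rw [hQ _ (index_lt hμpos hμmono x.2.1 x.2.2 i)])
  have hpoly : ∀ k, IsPolyFun (q k) := by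
    intro k
    induction k using Nat.strong_induction_on with
    | _ k ih =>
      have hX : IsPolyFun (Xi k q) := by
        simp only [Xi]
        split_ifs with h
        · have h2 := ih _ (hlt h.choose_spec)
          exact (h2.smul _).sub h2.exists_deriv.2
        · exact IsPolyFun.zero
      obtain ⟨M, hM⟩ := exists_nat_ge (μ k / μ 0)
      rw [div_le_iff₀ (hμpos 0)] at hM
      have e : q k = fun s => Matrix.toLin' B
          ((∑ x ∈ idx M k with (∑ i, μ (x.2 i)) = μ k,
              𝒢 x.1 (fun i => q (x.2 i) s)) + p k s + Xi k q s) := by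
        rw [hq k]
        funext s
        simp only [F, Matrix.toLin'_apply]
        rw [finsum_index hμpos hμmono le_rfl hM (fun x => 𝒢 x.1 (fun i => q (x.2 i) s))]
      rw [e]
      refine IsPolyFun.linear ?_ _
      refine IsPolyFun.add (IsPolyFun.add (IsPolyFun.sum _ fun x hx => ?_) (hp k)) hX
      refine IsPolyFun.multilinear _ fun i => ih _ ?_
      rw [Finset.mem_filter, idx, Finset.mem_sigma, Finset.mem_Icc] at hx
      exact index_lt hμpos hμmono hx.1.1.1 hx.2 i
  refine ⟨q, fun k => Xi k q, hpoly, fun k l hl => ?_, fun k hk => ?_, fun k s => ?_⟩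
  · have h : ∃ l, μ l + 1 = μ k := ⟨l, hl⟩
    have e : h.choose = l := hμmono.injective (by have := h.choose_spec; linarith)
    simp only [Xi]
    rw [dif_pos h, e]
  · simp only [Xi]
    rw [dif_neg hk]
  · conv_lhs => rw [hq k]

theorem deriv_term {n : ℕ} {q : ℝ → Fin n → ℝ} (hq : IsPolyFun q) (m : ℝ) {t : ℝ} (ht : 0 < t) :
    HasDerivAt (fun t : ℝ => t ^ (-m) • q (Real.log t))
      (-(t ^ (-(m + 1)) • (m • q (Real.log t) - deriv q (Real.log t)))) t := by
  have h1 : HasDerivAt (fun t : ℝ => t ^ (-m)) ((-m) * t ^ (-m - 1)) t :=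
    Real.hasDerivAt_rpow_const (Or.inl ht.ne')
  have h2 : HasDerivAt (fun t : ℝ => q (Real.log t)) (t⁻¹ • deriv q (Real.log t)) t :=
    HasDerivAt.scomp t (hq.exists_deriv.1 (Real.log t)) (Real.hasDerivAt_log ht.ne')
  have h3 := h1.fun_smul h2
  have e1 : t ^ (-m - 1) = t ^ (-m) * t⁻¹ := by
    rw [Real.rpow_sub ht, Real.rpow_one, div_eq_mul_inv]
  have e2 : t ^ (-(m + 1)) = t ^ (-m) * t⁻¹ := by
    rw [← e1]
    congr 1
    ring
  have e3 : t ^ (-m) • t⁻¹ • deriv q (Real.log t) + (-m * t ^ (-m - 1)) • q (Real.log t) =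
      -(t ^ (-(m + 1)) • (m • q (Real.log t) - deriv q (Real.log t))) := by
    rw [e1, e2]
    module
  rw [e3] at h3
  exact h3

theorem multilinear_expand {n N m : ℕ}
    (F : MultilinearMap ℝ (fun _ : Fin m => (Fin n → ℝ)) (Fin n → ℝ)) (μ : ℕ → ℝ)
    (q : ℕ → Fin n → ℝ) {t : ℝ} (ht : 0 < t) :
    F (fun _ => ∑ k ∈ Finset.range (N + 1), t ^ (-μ k) • q k) =
      ∑ j ∈ Fintype.piFinset (fun _ : Fin m => Finset.range (N + 1)),
        t ^ (-∑ i, μ (j i)) • F (fun i => q (j i)) := by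
  rw [MultilinearMap.map_sum_finset]
  refine Finset.sum_congr rfl fun j _ => ?_
  rw [MultilinearMap.map_smul_univ, ← Real.rpow_sum_of_pos ht, Finset.sum_neg_distrib]

/-- Theorem 4.4, Type 2: power-logarithm asymptotic expansion
`y(t) ~ Σ q_k(ln t) t^{-μ_k}` of decaying solutions of `y' = -Ay + G(y) + f(t)` when
`f(t) ~ Σ p_k(ln t) t^{-μ_k}`. Indices start at `0`, so the paper's `μ_1` is `μ 0`. -/
theorem stmt18 (n : ℕ) (hn : 0 < n)
    (S : Matrix (Fin n) (Fin n) ℝ) (hS : IsUnit S)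
    (Λ : Fin n → ℝ) (hΛ : ∀ i, 0 < Λ i)
    (A : Matrix (Fin n) (Fin n) ℝ) (hA : A = S⁻¹ * Matrix.diagonal Λ * S)
    (G : (Fin n → ℝ) → (Fin n → ℝ)) (hG : LocallyLipschitz G)
    (𝒢 : ∀ m : ℕ, MultilinearMap ℝ (fun _ : Fin m => (Fin n → ℝ)) (Fin n → ℝ))
    (hGexp : ∀ N : ℕ, 2 ≤ N → ∃ δ > (0:ℝ), ∃ C r : ℝ, 0 < C ∧ 0 < r ∧
      ∀ v : Fin n → ℝ, ‖v‖ < r →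
        ‖G v - ∑ m ∈ Finset.Icc 2 N, 𝒢 m (fun _ => v)‖ ≤ C * ‖v‖ ^ ((N : ℝ) + δ))
    (μ : ℕ → ℝ) (hμpos : ∀ k, 0 < μ k) (hμmono : StrictMono μ)
    (hμdiv : Filter.Tendsto μ Filter.atTop Filter.atTop)
    (hμadd : ∀ a b : ℕ, ∃ c : ℕ, μ c = μ a + μ b)
    (hμone : ∀ a : ℕ, ∃ c : ℕ, μ c = μ a + 1)
    (p : ℕ → ℝ → Fin n → ℝ) (hp : ∀ k, IsPolyFun (p k))
    (f : ℝ → Fin n → ℝ) (hfcont : ∃ Tf : ℝ, ContinuousOn f (Set.Ici Tf))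
    (hf : ∀ N : ℕ, ∃ μ' > μ N, ∃ C T : ℝ, 0 < C ∧ ∀ t ≥ T,
      ‖f t - ∑ k ∈ Finset.range (N + 1), t ^ (-(μ k)) • p k (Real.log t)‖ ≤
        C * t ^ (-μ'))
    (T₀ : ℝ) (y : ℝ → Fin n → ℝ)
    (hode : ∀ t > T₀, HasDerivAt y (-(A.mulVec (y t)) + G (y t) + f t) t)
    (hdecay : Filter.Tendsto y Filter.atTop (nhds 0)) :
    ∃ q χ : ℕ → ℝ → Fin n → ℝ,
      (∀ k, IsPolyFun (q k)) ∧
      -- the correction terms `χ_k`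
      (∀ k l : ℕ, μ l + 1 = μ k → χ k = fun s => μ l • q l s - deriv (q l) s) ∧
      (∀ k : ℕ, (¬∃ l, μ l + 1 = μ k) → χ k = 0) ∧
      -- the recursive formulas (the double sum is empty for the smallest index)
      (∀ (k : ℕ) (s : ℝ),
        q k s = A⁻¹.mulVec
          ((∑ᶠ x : {x : Σ m : ℕ, Fin m → ℕ // 2 ≤ x.1 ∧ (∑ i, μ (x.2 i)) = μ k},
              𝒢 x.1.1 (fun i => q (x.1.2 i) s)) + p k s + χ k s)) ∧
      -- the asymptotic expansion of the solution
      (∀ N : ℕ, ∃ μ' > μ N, ∃ C T : ℝ, 0 < C ∧ ∀ t ≥ T,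
        ‖y t - ∑ k ∈ Finset.range (N + 1), t ^ (-(μ k)) • q k (Real.log t)‖ ≤
          C * t ^ (-μ')) := by
  have hdetS : IsUnit S.det := (Matrix.isUnit_iff_isUnit_det S).1 hS
  have hAu : IsUnit A.det := by
    rw [← Matrix.isUnit_iff_isUnit_det, hA]
    refine IsUnit.mul (IsUnit.mul ?_ ?_) hS
    · exact (Matrix.isUnit_nonsing_inv_iff).2 hS
    · rw [Matrix.isUnit_diagonal, Pi.isUnit_iff]
      exact fun i => (hΛ i).ne'.isUnit
  obtain ⟨q, χ, hqpoly, hχ1, hχ2, hq⟩ := exists_coeffs A⁻¹ 𝒢 hμpos hμmono hp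
  refine ⟨q, χ, hqpoly, hχ1, hχ2, hq, ?_⟩
  -- the remainder of `f`
  have hfS : ∀ N : ℕ, Sm (μ N)
      (fun t => f t - ∑ k ∈ Finset.range (N + 1), t ^ (-(μ k)) • p k (Real.log t)) := by
    intro N
    obtain ⟨μ', hμ', C, T, hC, h⟩ := hf N
    refine ⟨μ', hμ', IsBigO.of_bound C ?_⟩
    filter_upwards [eventually_ge_atTop T, eventually_gt_atTop 0] with t ht ht0
    rw [Real.norm_of_nonneg (Real.rpow_nonneg ht0.le _)]
    exact h t ht
  have hf0 : Sm 0 f := by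
    have h1 := ((hfS 0).mono (hμpos 0).le).add (Sm.poly (hμpos 0) (hp 0))
    simpa using h1
  -- the remainder of `G`
  have hGP : ∀ M : ℕ, 2 ≤ M →
      (fun t => G (y t) - ∑ m ∈ Finset.Icc 2 M, 𝒢 m (fun _ => y t)) =O[atTop]
        fun t => ‖y t‖ ^ M := by
    intro M hM
    obtain ⟨δ, hδ, C, r, hC, hr, h⟩ := hGexp M hM
    refine IsBigO.of_bound C ?_
    have hyn : Tendsto (fun t => ‖y t‖) atTop (𝓝 0) := by simpa using hdecay.norm
    filter_upwards [hyn.eventually (gt_mem_nhds hr), hyn.eventually (gt_mem_nhds one_pos)]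
      with t h1 h2
    refine (h _ h1).trans ?_
    rw [norm_pow, norm_norm]
    gcongr
    rw [← Real.rpow_natCast]
    exact Real.rpow_le_rpow_of_exponent_ge' (norm_nonneg _) h2.le (by positivity) (by linarith)
  have hGo : (fun t => G (y t)) =o[atTop] y := by
    have h1 : (fun t => G (y t) - ∑ m ∈ Finset.Icc 2 2, 𝒢 m (fun _ => y t)) =o[atTop] y := by
      refine (hGP 2 le_rfl).trans_isLittleO ?_
      have h2 : (fun t => ‖y t‖) =o[atTop] fun _ => (1 : ℝ) := by
        rw [isLittleO_one_iff]
        simpa using hdecay.norm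
      have h3 := h2.mul_isBigO (isBigO_refl (fun t => ‖y t‖) atTop)
      simp only [one_mul, ← pow_two] at h3
      exact h3.of_norm_right
    have h4 := multilinear_isLittleO le_rfl (𝒢 2) hdecay (tendsto_const_nhds (x := 0))
    have h5 : 𝒢 2 (fun _ => 0) = 0 := (𝒢 2).map_coord_zero (0 : Fin 2) rfl
    simp only [h5, sub_zero] at h4
    have h6 := h1.add h4
    simpa using h6
  -- first decay estimate
  obtain ⟨α, hα, hyα⟩ : Sm 0 y := by
    obtain ⟨β, hβ, hfβ⟩ := hf0
    refine ⟨β, hβ, linear_decay hn hS hΛ hA hβ ?_ hGo hfβ⟩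
    filter_upwards [eventually_gt_atTop T₀] with t ht
    rw [← add_assoc]
    exact hode t ht
  intro N
  classical
  -- choice of the truncation order
  obtain ⟨M, hM2, hMμ, hMα⟩ : ∃ M : ℕ, 2 ≤ M ∧ μ N ≤ M * μ 0 ∧ μ N < α * M := by
    obtain ⟨M1, h1⟩ := exists_nat_ge (μ N / μ 0)
    obtain ⟨M2, h2⟩ := exists_nat_gt (μ N / α)
    rw [div_le_iff₀ (hμpos 0)] at h1
    rw [div_lt_iff₀ hα] at h2
    have h0 := hμpos 0
    have e1 : (M1 : ℝ) ≤ ((M1 + M2 + 2 : ℕ) : ℝ) := by exact_mod_cast (by omega)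
    have e2 : (M2 : ℝ) ≤ ((M1 + M2 + 2 : ℕ) : ℝ) := by exact_mod_cast (by omega)
    refine ⟨M1 + M2 + 2, by omega, ?_, ?_⟩
    · exact h1.trans (by gcongr)
    · rw [mul_comm]
      exact h2.trans_le (by gcongr)
  set Y : ℝ → Fin n → ℝ :=
    fun t => ∑ k ∈ Finset.range (N + 1), t ^ (-(μ k)) • q k (Real.log t) with hY
  have hY0 : Tendsto Y atTop (𝓝 0) :=
    (Sm.sum _ fun k _ => Sm.poly (hμpos k) (hqpoly k)).tendsto
  set P : (Fin n → ℝ) → Fin n → ℝ := fun v => ∑ m ∈ Finset.Icc 2 M, 𝒢 m (fun _ => v) with hP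
  have hh1 : (fun t => P (y t) - P (Y t)) =o[atTop] fun t => y t - Y t := by
    simp only [hP, ← Finset.sum_sub_distrib]
    exact IsLittleO.fun_sum fun m hm =>
      multilinear_isLittleO (Finset.mem_Icc.1 hm).1 (𝒢 m) hdecay hY0
  have hr0 : Sm (μ N) (fun t => G (y t) - P (y t)) := by
    refine ⟨α * M, hMα, (hGP M hM2).trans ?_⟩
    refine (hyα.norm_left.pow M).trans (EventuallyEq.isBigO ?_)
    filter_upwards [eventually_gt_atTop 0] with t ht
    rw [← Real.rpow_natCast, ← Real.rpow_mul ht.le]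
    congr 1
    ring
  have hr1 := Sm.regroup hμmono N (idx M N) (fun x => ∑ i, μ (x.2 i))
    (fun x hx => by
      rw [idx, Finset.mem_sigma, Finset.mem_Icc] at hx
      exact index_mem hμadd (by omega) x.2)
    (fun x s => 𝒢 x.1 (fun i => q (x.2 i) s))
    (fun x _ => IsPolyFun.multilinear _ fun i => hqpoly _)
  have hr2 := Sm.regroup hμmono N (Finset.range (N + 1)) (fun l => μ l + 1)
    (fun l _ => hμone l) (fun l s => μ l • q l s - deriv (q l) s)
    (fun l _ => ((hqpoly l).smul _).sub (hqpoly l).exists_deriv.2)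
  obtain ⟨β, hβ, hh2⟩ := ((hr0.add (hfS N)).add hr1).add hr2
  -- the algebraic identity
  have hAq : ∀ k ∈ Finset.range (N + 1), ∀ s, A.mulVec (q k s) =
      (∑ x ∈ idx M N with (∑ i, μ (x.2 i)) = μ k, 𝒢 x.1 (fun i => q (x.2 i) s)) + p k s +
      ∑ l ∈ Finset.range (N + 1) with μ l + 1 = μ k, (μ l • q l s - deriv (q l) s) := by
    intro k hk s
    have hkN : k ≤ N := by
      have := Finset.mem_range.1 hk
      omega
    rw [hq k s, Matrix.mulVec_mulVec, Matrix.mul_nonsing_inv A hAu, Matrix.one_mulVec,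
      finsum_index hμpos hμmono hkN hMμ (fun x => 𝒢 x.1 (fun i => q (x.2 i) s))]
    congr 1
    by_cases hl : ∃ l, μ l + 1 = μ k
    · obtain ⟨l, hl⟩ := hl
      have hlk : l < k := hμmono.lt_iff_lt.1 (by linarith)
      have e : (Finset.range (N + 1)).filter (fun l => μ l + 1 = μ k) = {l} := by
        ext l'
        simp only [Finset.mem_filter, Finset.mem_range, Finset.mem_singleton]
        constructor
        · rintro ⟨_, h⟩
          exact hμmono.injective (by linarith)
        · rintro rfl
          exact ⟨by omega, hl⟩
      rw [e, Finset.sum_singleton, hχ1 k l hl]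
    · have e : (Finset.range (N + 1)).filter (fun l => μ l + 1 = μ k) = ∅ := by
        ext l'
        simp only [Finset.mem_filter, Finset.notMem_empty, iff_false]
        exact fun h => hl ⟨l', h.2⟩
      rw [e, Finset.sum_empty, hχ2 k hl]
      rfl
  have hAY : ∀ t, A.mulVec (Y t) =
      ∑ k ∈ Finset.range (N + 1), t ^ (-μ k) • (∑ x ∈ idx M N with (∑ i, μ (x.2 i)) = μ k,
        𝒢 x.1 (fun i => q (x.2 i) (Real.log t))) +
      ∑ k ∈ Finset.range (N + 1), t ^ (-μ k) • p k (Real.log t) +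
      ∑ k ∈ Finset.range (N + 1), t ^ (-μ k) • ∑ l ∈ Finset.range (N + 1) with μ l + 1 = μ k,
        (μ l • q l (Real.log t) - deriv (q l) (Real.log t)) := by
    intro t
    rw [← Finset.sum_add_distrib, ← Finset.sum_add_distrib]
    simp only [hY, Matrix.mulVec_sum, Matrix.mulVec_smul]
    refine Finset.sum_congr rfl fun k hk => ?_
    rw [hAq k hk, smul_add, smul_add]
  have hPY : ∀ t : ℝ, 0 < t → P (Y t) = ∑ x ∈ idx M N,
      t ^ (-∑ i, μ (x.2 i)) • 𝒢 x.1 (fun i => q (x.2 i) (Real.log t)) := by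
    intro t ht
    simp only [hP, hY, idx]
    rw [Finset.sum_sigma]
    exact Finset.sum_congr rfl fun m _ =>
      multilinear_expand (𝒢 m) μ (fun k => q k (Real.log t)) ht
  have hYd : ∀ t : ℝ, 0 < t → HasDerivAt Y (-∑ l ∈ Finset.range (N + 1),
      t ^ (-(μ l + 1)) • (μ l • q l (Real.log t) - deriv (q l) (Real.log t))) t := by
    intro t ht
    rw [← Finset.sum_neg_distrib]
    exact HasDerivAt.fun_sum fun l _ => deriv_term (hqpoly l) (μ l) ht
  have hfin := linear_decay hn hS hΛ hA ((hμpos N).trans hβ) (w := fun t => y t - Y t) (by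
    filter_upwards [eventually_gt_atTop T₀, eventually_gt_atTop 0] with t ht ht0
    refine ((hode t ht).fun_sub (hYd t ht0)).congr_deriv ?_
    rw [Matrix.mulVec_sub, hAY t, hPY t ht0]
    module) hh1 hh2
  obtain ⟨C, hC, hCb⟩ := hfin.exists_pos
  obtain ⟨T, hT⟩ := eventually_atTop.1 (hCb.bound.and (eventually_gt_atTop 0))
  refine ⟨β, hβ, C, T, hC, fun t ht => ?_⟩
  have h1 := (hT t ht).1
  rwa [Real.norm_of_nonneg (Real.rpow_nonneg (hT t ht).2.le _)] at h1
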